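/- arXiv:2405.07393 — 4 statements merged into one kernel-verified Lean document; each statement's English description precedes it below -/
import Mathlib

section
/- For any measurable binary classifier f : 𝒳 → {0,1}, the accuracy Acc(f) = ℙ(f(X) = Y) satisfies Acc(f) ≤ max(1 − α, α) + min(1 − α, α) · d_TV(P₁, P₀). -/
open MeasureTheory ProbabilityTheory

/-- Total variation distance between two measures: the supremum over measurable
sets `A` of `|P(A) - Q(A)|`. -/
noncomputable def dTV {𝒳 : Type*} [MeasurableSpace 𝒳] (P Q : Measure 𝒳) : ℝ :=
  ⨆ A : {A : Set 𝒳 // MeasurableSet A}, |(P A.1).toReal - (Q A.1).toReal|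

/-- Unconstrained upper bound on accuracy (Theorem 1):
`Acc(f) ≤ max(1 − α, α) + min(1 − α, α) · d_TV(P₁, P₀)`. -/
theorem unconstrained_accuracy_upper_bound
    {Ω 𝒳 : Type*} [MeasurableSpace Ω] [MeasurableSpace 𝒳]
    (Pr : Measure Ω) [IsProbabilityMeasure Pr]
    (X : Ω → 𝒳) (hX : Measurable X)
    (Y : Ω → Bool) (hY : Measurable Y)
    (α : ℝ) (hα : α = (Pr {ω | Y ω = true}).toReal)
    (hα0 : 0 < α) (hα1 : α < 1)
    (P₀ P₁ : Measure 𝒳)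
    (hP₀ : P₀ = (Pr[|{ω | Y ω = false}]).map X)
    (hP₁ : P₁ = (Pr[|{ω | Y ω = true}]).map X)
    (f : 𝒳 → Bool) (hf : Measurable f)
    :
    (Pr {ω | f (X ω) = Y ω}).toReal ≤ max (1 - α) α + min (1 - α) α * dTV P₁ P₀ := by
  classical
  have hT : MeasurableSet {ω | Y ω = true} := hY (measurableSet_singleton true)
  have hF : MeasurableSet {ω | Y ω = false} := hY (measurableSet_singleton false)
  have hFc : {ω | Y ω = false} = {ω | Y ω = true}ᶜ := by ext ω; simp
  have hα' : Pr.real {ω | Y ω = true} = α := hα.symm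
  have hβ' : Pr.real {ω | Y ω = false} = 1 - α := by
    rw [hFc, probReal_compl_eq_one_sub hT, hα']
  have hA : MeasurableSet (f ⁻¹' {true}) := hf (measurableSet_singleton true)
  have nT : Pr {ω | Y ω = true} ≠ 0 := by
    intro h; simp [Measure.real, h] at hα'; linarith
  have nF : Pr {ω | Y ω = false} ≠ 0 := by
    intro h; simp [Measure.real, h] at hβ'; linarith
  have := cond_isProbabilityMeasure (μ := Pr) nT
  have := cond_isProbabilityMeasure (μ := Pr) nF
  have : IsProbabilityMeasure P₁ := by
    rw [hP₁]; exact Measure.isProbabilityMeasure_map hX.aemeasurable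
  have : IsProbabilityMeasure P₀ := by
    rw [hP₀]; exact Measure.isProbabilityMeasure_map hX.aemeasurable
  have hd : P₁.real (f ⁻¹' {true}) - P₀.real (f ⁻¹' {true}) ≤ dTV P₁ P₀ := by
    refine (le_abs_self _).trans ?_
    refine le_ciSup (f := fun A : {A : Set 𝒳 // MeasurableSet A} =>
      |(P₁ A.1).toReal - (P₀ A.1).toReal|) ⟨1, ?_⟩ ⟨f ⁻¹' {true}, hA⟩
    rintro _ ⟨B, rfl⟩
    have h1 : P₁.real B.1 ≤ 1 := measureReal_le_one
    have h2 : P₀.real B.1 ≤ 1 := measureReal_le_one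
    have h3 : 0 ≤ P₁.real B.1 := measureReal_nonneg
    have h4 : 0 ≤ P₀.real B.1 := measureReal_nonneg
    simp only [Measure.real] at h1 h2 h3 h4
    exact abs_le.2 ⟨by linarith, by linarith⟩
  have hc : ∀ S : Set Ω, MeasurableSet S → ∀ B : Set Ω,
      (Pr[|S]).real B = (Pr.real S)⁻¹ * Pr.real (S ∩ B) := by
    intro S hS B
    simp only [Measure.real]
    rw [cond_apply hS, ENNReal.toReal_mul, ENNReal.toReal_inv]
  have e1 : Pr.real ({ω | Y ω = true} ∩ X ⁻¹' (f ⁻¹' {true})) = α * P₁.real (f ⁻¹' {true}) := by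
    rw [hP₁, map_measureReal_apply hX hA, hc _ hT, hα']
    field_simp
  have e0 : Pr.real ({ω | Y ω = false} ∩ X ⁻¹' (f ⁻¹' {true})ᶜ)
      = (1 - α) * (1 - P₀.real (f ⁻¹' {true})) := by
    rw [← probReal_compl_eq_one_sub hA, hP₀, map_measureReal_apply hX hA.compl,
      hc _ hF, hβ']
    have : 1 - α ≠ 0 := by linarith
    field_simp
  have hs : {ω | f (X ω) = Y ω} = ({ω | Y ω = true} ∩ X ⁻¹' (f ⁻¹' {true}))
      ∪ ({ω | Y ω = false} ∩ X ⁻¹' (f ⁻¹' {true})ᶜ) := by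
    ext ω
    cases h : Y ω <;> cases h' : f (X ω) <;> simp [h, h']
  have hacc : Pr.real {ω | f (X ω) = Y ω} = α * P₁.real (f ⁻¹' {true})
      + (1 - α) * (1 - P₀.real (f ⁻¹' {true})) := by
    rw [hs, measureReal_union _ (hF.inter (hX hA.compl)), e1, e0]
    rw [Set.disjoint_left]
    rintro ω ⟨h1, _⟩ ⟨h2, _⟩
    simp_all
  change Pr.real {ω | f (X ω) = Y ω} ≤ _
  rw [hacc]
  have hp : P₁.real (f ⁻¹' {true}) ≤ 1 := measureReal_le_one
  have hq : 0 ≤ P₀.real (f ⁻¹' {true}) := measureReal_nonneg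
  generalize P₁.real (f ⁻¹' {true}) = p at *
  generalize P₀.real (f ⁻¹' {true}) = q at *
  rcases le_total α (1 - α) with h | h
  · rw [max_eq_left h, min_eq_right h]
    nlinarith [mul_le_mul_of_nonneg_left hd hα0.le, mul_nonneg (sub_nonneg.2 h) hq]
  · rw [max_eq_right h, min_eq_left h]
    nlinarith [mul_le_mul_of_nonneg_left hd (sub_nonneg.2 hα1.le),
      mul_nonneg (sub_nonneg.2 h) (sub_nonneg.2 hp)]
end

section
/- For any measurable binary classifier f : 𝒳 → {0,1} satisfying the approximate equalized-odds constraint Δ_EO(f) ≤ ε_EO, its accuracy satisfies Acc(f) ≤ max(1 − α, α) + min(T₁, T₂), where T₁ = min(1 − α, α) · d_TV(P₁ᵇ, P₀ᵇ) + β·ε_EO and T₂ = min(1 − α, α) · d_TV(P₁ᵃ, P₀ᵃ) + (1 − β)·ε_EO. -/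
open MeasureTheory ProbabilityTheory

lemma eo_dTV_ge {𝒳 : Type*} [MeasurableSpace 𝒳] (P Q : Measure 𝒳)
    [IsProbabilityMeasure P] [IsProbabilityMeasure Q] (A : Set 𝒳) (hA : MeasurableSet A) :
    (P A).toReal - (Q A).toReal ≤ dTV P Q := by
  refine (le_abs_self _).trans ?_
  refine le_ciSup (f := fun A : {A : Set 𝒳 // MeasurableSet A} =>
    |(P A.1).toReal - (Q A.1).toReal|) ?_ ⟨A, hA⟩
  refine ⟨1, ?_⟩
  rintro _ ⟨B, rfl⟩
  have h1 : P.real B.1 ≤ 1 := measureReal_le_one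
  have h2 : Q.real B.1 ≤ 1 := measureReal_le_one
  have h3 : 0 ≤ P.real B.1 := measureReal_nonneg
  have h4 : 0 ≤ Q.real B.1 := measureReal_nonneg
  simp only [measureReal_def] at h1 h2 h3 h4
  exact abs_le.2 ⟨by linarith, by linarith⟩

lemma eo_split {Ω : Type*} [MeasurableSpace Ω] (Pr : Measure Ω) [IsProbabilityMeasure Pr]
    (Y : Ω → Bool) (hY : Measurable Y) (S : Set Ω) :
    Pr.real S = Pr.real (S ∩ {ω | Y ω = true}) + Pr.real (S ∩ {ω | Y ω = false}) := by
  have hm : MeasurableSet {ω | Y ω = true} := hY (measurableSet_singleton true)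
  have := measureReal_inter_add_diff (μ := Pr) (s := S) hm
  rw [← this]
  congr 2
  ext ω
  simp

lemma eo_arith (α a b r1 r0 s1 s0 p q ε d m : ℝ) (hp : 0 ≤ p) (hq : 0 ≤ q)
    (ha : 0 ≤ a) (hb : 0 ≤ b) (hα : α = a + p) (hα' : 1 - α = b + q)
    (h1 : |s1 - r1| ≤ ε) (h0 : |s0 - r0| ≤ ε) (hr1 : r1 ≤ 1) (hr0 : 0 ≤ r0)
    (hd : r1 - r0 ≤ d) (hm : m = p + q) :
    a * r1 + b * (1 - r0) + p * s1 + q * (1 - s0)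
      ≤ max (1 - α) α + (min (1 - α) α * d + m * ε) := by
  have e1 : p * s1 ≤ p * (r1 + ε) :=
    mul_le_mul_of_nonneg_left (by linarith [(abs_le.1 h1).2]) hp
  have e2 : q * (1 - s0) ≤ q * (1 - r0 + ε) :=
    mul_le_mul_of_nonneg_left (by linarith [(abs_le.1 h0).1]) hq
  have hL : a * r1 + b * (1 - r0) + p * s1 + q * (1 - s0)
      ≤ α * r1 + (1 - α) * (1 - r0) + m * ε := by
    rw [hα', hα, hm]; nlinarith
  have : α * r1 + (1 - α) * (1 - r0) ≤ max (1 - α) α + min (1 - α) α * d := by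
    rcases le_total (1 - α) α with h | h
    · rw [max_eq_right h, min_eq_left h]
      have h3 : (1 - α) * (r1 - r0) ≤ (1 - α) * d :=
        mul_le_mul_of_nonneg_left hd (by linarith)
      nlinarith [mul_nonneg (sub_nonneg.2 h) (sub_nonneg.2 hr1)]
    · rw [max_eq_left h, min_eq_right h]
      have h3 : α * (r1 - r0) ≤ α * d :=
        mul_le_mul_of_nonneg_left hd (by linarith)
      nlinarith [mul_nonneg (sub_nonneg.2 h) hr0]
  linarith

/-- Fairness-accuracy tradeoff under approximate equalized odds (Theorem 2):
for any classifier `f` with `Δ_EO(f) ≤ ε_EO`,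
`Acc(f) ≤ max(1 − α, α) + min(T₁, T₂)` where
`T₁ = min(1 − α, α)·d_TV(P₁ᵇ, P₀ᵇ) + β·ε_EO` and
`T₂ = min(1 − α, α)·d_TV(P₁ᵃ, P₀ᵃ) + (1 − β)·ε_EO`.
Here `Z = true` encodes group `a` and `Z = false` encodes group `b`. -/
theorem eo_fairness_accuracy_tradeoff
    {Ω 𝒳 : Type*} [MeasurableSpace Ω] [MeasurableSpace 𝒳]
    (Pr : Measure Ω) [IsProbabilityMeasure Pr]
    (X : Ω → 𝒳) (hX : Measurable X)
    (Y Z : Ω → Bool) (hY : Measurable Y) (hZ : Measurable Z)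
    (hpos : ∀ y z : Bool, 0 < Pr {ω | Y ω = y ∧ Z ω = z})
    (α β : ℝ)
    (hα : α = (Pr {ω | Y ω = true}).toReal)
    (hβ : β = (Pr {ω | Z ω = true}).toReal)
    (P₀a P₁a P₀b P₁b : Measure 𝒳)
    (hP₀a : P₀a = (Pr[|{ω | Y ω = false ∧ Z ω = true}]).map X)
    (hP₁a : P₁a = (Pr[|{ω | Y ω = true ∧ Z ω = true}]).map X)
    (hP₀b : P₀b = (Pr[|{ω | Y ω = false ∧ Z ω = false}]).map X)
    (hP₁b : P₁b = (Pr[|{ω | Y ω = true ∧ Z ω = false}]).map X)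
    (f : 𝒳 → Bool) (hf : Measurable f)
    (εEO : ℝ)
    (hEO : max
      |(Pr[|{ω | Z ω = true ∧ Y ω = true}] {ω | f (X ω) = true}).toReal -
        (Pr[|{ω | Z ω = false ∧ Y ω = true}] {ω | f (X ω) = true}).toReal|
      |(Pr[|{ω | Z ω = true ∧ Y ω = false}] {ω | f (X ω) = true}).toReal -
        (Pr[|{ω | Z ω = false ∧ Y ω = false}] {ω | f (X ω) = true}).toReal|
      ≤ εEO) :
    (Pr {ω | f (X ω) = Y ω}).toReal
      ≤ max (1 - α) α +
        min (min (1 - α) α * dTV P₁b P₀b + β * εEO)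
            (min (1 - α) α * dTV P₁a P₀a + (1 - β) * εEO) := by
  have hYZ : ∀ y z : Bool, MeasurableSet {ω | Y ω = y ∧ Z ω = z} := fun y z =>
    (hY (measurableSet_singleton y)).inter (hZ (measurableSet_singleton z))
  have hprob : ∀ y z : Bool, IsProbabilityMeasure (Pr[|{ω | Y ω = y ∧ Z ω = z}]) := fun y z =>
    cond_isProbabilityMeasure (hpos y z).ne'
  have hfA : MeasurableSet {x | f x = true} := hf (measurableSet_singleton true)
  set F : Set Ω := {ω | f (X ω) = true} with hF
  have hFm : MeasurableSet F := hX hfA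
  have hcomm : ∀ y z : Bool, {ω | Z ω = z ∧ Y ω = y} = {ω | Y ω = y ∧ Z ω = z} := by
    intro y z; ext ω; exact and_comm
  simp only [hcomm] at hEO
  obtain ⟨hE1, hE0⟩ := max_le_iff.1 hEO
  set p : Bool → Bool → ℝ := fun y z => Pr.real {ω | Y ω = y ∧ Z ω = z} with hp
  set r : Bool → Bool → ℝ := fun y z => (Pr[|{ω | Y ω = y ∧ Z ω = z}] F).toReal with hr
  have hp0 : ∀ y z, 0 ≤ p y z := fun y z => measureReal_nonneg
  have hr0 : ∀ y z, 0 ≤ r y z := fun y z => ENNReal.toReal_nonneg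
  have hr1 : ∀ y z, r y z ≤ 1 := fun y z => by
    have := hprob y z
    exact measureReal_le_one (μ := Pr[|{ω | Y ω = y ∧ Z ω = z}])
  have hq : ∀ y z, Pr.real ({ω | Y ω = y ∧ Z ω = z} ∩ F) = p y z * r y z := by
    intro y z
    have := cond_mul_eq_inter (μ := Pr) (hYZ y z) F
    simp only [hp, hr, measureReal_def]
    rw [← this, ENNReal.toReal_mul, mul_comm]
  have hq' : ∀ y z, Pr.real ({ω | Y ω = y ∧ Z ω = z} \ F) = p y z * (1 - r y z) := by
    intro y z
    have := measureReal_inter_add_diff (μ := Pr) (s := {ω | Y ω = y ∧ Z ω = z}) hFm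
    rw [hq] at this
    have h2 : p y z = Pr.real {ω | Y ω = y ∧ Z ω = z} := rfl
    rw [← h2] at this
    linarith
  have hYs : ∀ y, Pr.real {ω | Y ω = y} = p y true + p y false := fun y =>
    eo_split Pr Z hZ _
  have hα1 : α = p true true + p true false := by rw [hα]; exact hYs true
  have hβ1 : β = p true true + p false true := by
    rw [hβ]
    refine (eo_split Pr Y hY _).trans ?_
    simp only [hp, ← hcomm]
    rfl
  have htot : p true true + p true false + (p false true + p false false) = 1 := by
    rw [← hYs, ← hYs]
    have := eo_split Pr Y hY Set.univ
    simpa using this.symm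
  have hacc : (Pr {ω | f (X ω) = Y ω}).toReal
      = p true true * r true true + p true false * r true false
        + (p false true * (1 - r false true) + p false false * (1 - r false false)) := by
    rw [← hq, ← hq, ← hq', ← hq']
    change Pr.real _ = _
    rw [eo_split Pr Y hY, eo_split Pr Z hZ ({ω | f (X ω) = Y ω} ∩ {ω | Y ω = true}),
      eo_split Pr Z hZ ({ω | f (X ω) = Y ω} ∩ {ω | Y ω = false})]
    congr 1 <;> congr 1 <;> congr 1 <;> ext ω <;> simp only [hF, Set.mem_inter_iff,
      Set.mem_diff, Set.mem_setOf_eq] <;> cases Y ω <;> cases Z ω <;> cases f (X ω) <;> simp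
  have hTV : ∀ z, r true z - r false z ≤ dTV ((Pr[|{ω | Y ω = true ∧ Z ω = z}]).map X)
      ((Pr[|{ω | Y ω = false ∧ Z ω = z}]).map X) := by
    intro z
    have := hprob true z
    have := hprob false z
    have := Measure.isProbabilityMeasure_map (μ := Pr[|{ω | Y ω = true ∧ Z ω = z}]) hX.aemeasurable
    have := Measure.isProbabilityMeasure_map (μ := Pr[|{ω | Y ω = false ∧ Z ω = z}]) hX.aemeasurable
    have h := eo_dTV_ge ((Pr[|{ω | Y ω = true ∧ Z ω = z}]).map X)
      ((Pr[|{ω | Y ω = false ∧ Z ω = z}]).map X) _ hfA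
    rwa [Measure.map_apply hX hfA, Measure.map_apply hX hfA] at h
  rw [hacc, ← min_add_add_left, hP₀a, hP₁a, hP₀b, hP₁b]
  refine le_min ?_ ?_
  · have := eo_arith α (p true false) (p false false) (r true false) (r false false)
      (r true true) (r false true) (p true true) (p false true) εEO _ β (hp0 _ _) (hp0 _ _)
      (hp0 _ _) (hp0 _ _) (by linarith) (by linarith) hE1 hE0 (hr1 _ _) (hr0 _ _) (hTV false)
      (by linarith)
    linarith
  · rw [abs_sub_comm] at hE1 hE0
    have := eo_arith α (p true true) (p false true) (r true true) (r false true)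
      (r true false) (r false false) (p true false) (p false false) εEO _ (1 - β) (hp0 _ _) (hp0 _ _)
      (hp0 _ _) (hp0 _ _) (by linarith) (by linarith) hE1 hE0 (hr1 _ _) (hr0 _ _) (hTV true)
      (by linarith)
    linarith
end

section
/- Let f : 𝒳 → {0,1} be a measurable classifier with Δ_EO(f) ≤ ε_EO. Then Acc(f) ≤ (1 − α) + α·ℙ(f(X) = 1 | Y = 1, Z = b) − (1 − α)·ℙ(f(X) = 1 | Y = 0, Z = b) + β·ε_EO, where α = ℙ(Y = 1) and β = ℙ(Z = a). -/
open MeasureTheory ProbabilityTheory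

theorem eo_split_aux {Ω : Type*} [MeasurableSpace Ω] (Pr : Measure Ω) [IsProbabilityMeasure Pr]
    (W : Ω → Bool) (hW : Measurable W) (S : Set Ω) :
    (Pr S).toReal = (Pr (S ∩ {ω | W ω = true})).toReal + (Pr (S ∩ {ω | W ω = false})).toReal := by
  have hm : MeasurableSet {ω | W ω = true} := hW (measurableSet_singleton true)
  have h := measureReal_inter_add_sdiff (μ := Pr) (s := S) hm
  have e : S \ {ω | W ω = true} = S ∩ {ω | W ω = false} := by
    ext ω; simp
  rw [e] at h
  exact h.symm

theorem eo_cond_aux {Ω : Type*} [MeasurableSpace Ω] (Pr : Measure Ω) [IsProbabilityMeasure Pr]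
    (S T : Set Ω) (hS : MeasurableSet S) :
    (Pr (T ∩ S)).toReal = (Pr S).toReal * (Pr[|S] T).toReal := by
  have h := cond_mul_eq_inter (μ := Pr) hS T
  rw [Set.inter_comm, ← h, ENNReal.toReal_mul, mul_comm]

/-- For a classifier with `Δ_EO(f) ≤ ε_EO`:
`Acc(f) ≤ (1 − α) + α·ℙ(f(X)=1 | Y=1, Z=b) − (1 − α)·ℙ(f(X)=1 | Y=0, Z=b) + β·ε_EO`.
Here `Z = true` encodes group `a` and `Z = false` encodes group `b`. -/
theorem eo_accuracy_intermediate_bound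
    {Ω 𝒳 : Type*} [MeasurableSpace Ω] [MeasurableSpace 𝒳]
    (Pr : Measure Ω) [IsProbabilityMeasure Pr]
    (X : Ω → 𝒳) (hX : Measurable X)
    (Y Z : Ω → Bool) (hY : Measurable Y) (hZ : Measurable Z)
    (hpos : ∀ y z : Bool, 0 < Pr {ω | Y ω = y ∧ Z ω = z})
    (α β : ℝ)
    (hα : α = (Pr {ω | Y ω = true}).toReal)
    (hβ : β = (Pr {ω | Z ω = true}).toReal)
    (f : 𝒳 → Bool) (hf : Measurable f)
    (εEO : ℝ)
    (hEO : max
      |(Pr[|{ω | Z ω = true ∧ Y ω = true}] {ω | f (X ω) = true}).toReal -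
        (Pr[|{ω | Z ω = false ∧ Y ω = true}] {ω | f (X ω) = true}).toReal|
      |(Pr[|{ω | Z ω = true ∧ Y ω = false}] {ω | f (X ω) = true}).toReal -
        (Pr[|{ω | Z ω = false ∧ Y ω = false}] {ω | f (X ω) = true}).toReal|
      ≤ εEO) :
    (Pr {ω | f (X ω) = Y ω}).toReal
      ≤ (1 - α) + α * (Pr[|{ω | Y ω = true ∧ Z ω = false}] {ω | f (X ω) = true}).toReal
          - (1 - α) * (Pr[|{ω | Y ω = false ∧ Z ω = false}] {ω | f (X ω) = true}).toReal
          + β * εEO := by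
  have hc : ∀ y z : Bool, {ω | Z ω = z ∧ Y ω = y} = {ω | Y ω = y ∧ Z ω = z} := by
    intro y z; ext ω; simp [and_comm]
  simp only [hc] at hEO
  have hm : ∀ y z : Bool, MeasurableSet {ω | Y ω = y ∧ Z ω = z} := fun y z =>
    (hY (measurableSet_singleton y)).inter (hZ (measurableSet_singleton z))
  have hW : Measurable fun ω => f (X ω) := hf.comp hX
  have key : ∀ y z : Bool, (Pr {ω | f (X ω) = true ∧ Y ω = y ∧ Z ω = z}).toReal
      = (Pr {ω | Y ω = y ∧ Z ω = z}).toReal *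
        (Pr[|{ω | Y ω = y ∧ Z ω = z}] {ω | f (X ω) = true}).toReal := fun y z =>
    eo_cond_aux Pr _ {ω | f (X ω) = true} (hm y z)
  have hsplit : ∀ y z : Bool, (Pr {ω | Y ω = y ∧ Z ω = z}).toReal
      = (Pr {ω | f (X ω) = true ∧ Y ω = y ∧ Z ω = z}).toReal
        + (Pr {ω | f (X ω) = false ∧ Y ω = y ∧ Z ω = z}).toReal := by
    intro y z
    rw [eo_split_aux Pr _ hW {ω | Y ω = y ∧ Z ω = z}]
    congr 3 <;> (ext ω; simp only [Set.mem_inter_iff, Set.mem_setOf_eq]; tauto)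
  have hYs : ∀ y : Bool, (Pr {ω | Y ω = y}).toReal = (Pr {ω | Y ω = y ∧ Z ω = true}).toReal
      + (Pr {ω | Y ω = y ∧ Z ω = false}).toReal := fun y => eo_split_aux Pr Z hZ {ω | Y ω = y}
  have hZs : (Pr {ω | Z ω = true}).toReal = (Pr {ω | Y ω = true ∧ Z ω = true}).toReal
      + (Pr {ω | Y ω = false ∧ Z ω = true}).toReal := by
    rw [eo_split_aux Pr Y hY {ω | Z ω = true}]
    congr 3 <;> (ext ω; simp only [Set.mem_inter_iff, Set.mem_setOf_eq]; tauto)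
  have h1 : 1 = (Pr {ω | Y ω = true}).toReal + (Pr {ω | Y ω = false}).toReal := by
    have := eo_split_aux Pr Y hY Set.univ
    simpa using this
  have hA : (Pr {ω | f (X ω) = Y ω}).toReal
      = (Pr {ω | f (X ω) = true ∧ Y ω = true ∧ Z ω = true}).toReal
        + (Pr {ω | f (X ω) = true ∧ Y ω = true ∧ Z ω = false}).toReal
        + ((Pr {ω | f (X ω) = false ∧ Y ω = false ∧ Z ω = true}).toReal
        + (Pr {ω | f (X ω) = false ∧ Y ω = false ∧ Z ω = false}).toReal) := by
    rw [eo_split_aux Pr Y hY {ω | f (X ω) = Y ω},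
      eo_split_aux Pr Z hZ ({ω | f (X ω) = Y ω} ∩ {ω | Y ω = true}),
      eo_split_aux Pr Z hZ ({ω | f (X ω) = Y ω} ∩ {ω | Y ω = false})]
    congr 4 <;> (ext ω; simp only [Set.mem_inter_iff, Set.mem_setOf_eq]; cases f (X ω) <;> cases Y ω <;> simp)
  obtain ⟨e1, e0⟩ := max_le_iff.mp hEO
  have e1' := (abs_le.mp e1).2
  have e0' := (abs_le.mp e0).1
  have m1 := mul_le_mul_of_nonneg_left e1'
    (ENNReal.toReal_nonneg (a := Pr {ω | Y ω = true ∧ Z ω = true}))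
  have m0 := mul_le_mul_of_nonneg_left e0'
    (ENNReal.toReal_nonneg (a := Pr {ω | Y ω = false ∧ Z ω = true}))
  have s1 := hsplit false true
  have s2 := hsplit false false
  have hα' : 1 - α = (Pr {ω | Y ω = false}).toReal := by linarith
  rw [hα', hα, hβ, hA, hZs, hYs true, hYs false]
  rw [key] at s1 s2
  rw [key true true, key true false]
  nlinarith
end

section
/- Let f : 𝒳 → {0,1} be a measurable classifier satisfying perfect equalized odds, i.e., Δ_EO(f) = 0. Then Acc(f) ≤ max(α, 1 − α) + min(α, 1 − α) · min( d_TV(P₁ᵃ, P₀ᵃ), d_TV(P₁ᵇ, P₀ᵇ) ), where α = ℙ(Y = 1). In particular, under perfect equalized odds the accuracy of any classifier is limited by the subgroup with the smaller class-conditional total variation distance. -/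
open MeasureTheory ProbabilityTheory

/-- A single measurable event bounds the total variation from below. -/
lemma sub_le_dTV {𝒳 : Type*} [MeasurableSpace 𝒳] (P Q : Measure 𝒳)
    [IsProbabilityMeasure P] [IsProbabilityMeasure Q] {A : Set 𝒳} (hA : MeasurableSet A) :
    (P A).toReal - (Q A).toReal ≤ dTV P Q := by
  have hb : BddAbove (Set.range (fun A : {A : Set 𝒳 // MeasurableSet A} =>
      |(P A.1).toReal - (Q A.1).toReal|)) := by
    refine ⟨1, ?_⟩
    rintro _ ⟨B, rfl⟩
    have h1 : (P B.1).toReal ≤ 1 := measureReal_le_one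
    have h2 : (Q B.1).toReal ≤ 1 := measureReal_le_one
    have h3 : 0 ≤ (P B.1).toReal := ENNReal.toReal_nonneg
    have h4 : 0 ≤ (Q B.1).toReal := ENNReal.toReal_nonneg
    exact abs_le.2 ⟨by linarith, by linarith⟩
  exact (le_abs_self _).trans (le_ciSup hb ⟨A, hA⟩)

/-- Splitting an event according to a binary variable. -/
lemma split_bool {Ω : Type*} [MeasurableSpace Ω] (Pr : Measure Ω) [IsProbabilityMeasure Pr]
    (W : Ω → Bool) (hW : Measurable W) (p : Ω → Prop) :
    (Pr {ω | p ω}).toReal =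
      (Pr {ω | p ω ∧ W ω = true}).toReal + (Pr {ω | p ω ∧ W ω = false}).toReal := by
  have hm : MeasurableSet {ω | W ω = true} := hW (measurableSet_singleton true)
  have h := measureReal_inter_add_diff (μ := Pr) (s := {ω | p ω}) hm
  have e : {ω | p ω} \ {ω | W ω = true} = {ω | p ω ∧ W ω = false} := by
    ext ω; simp
  rw [e] at h
  exact h.symm

/-- The joint probability is the conditional one times the mass of the cell. -/
lemma joint_eq {Ω : Type*} [MeasurableSpace Ω] (Pr : Measure Ω) [IsProbabilityMeasure Pr]
    (Y Z : Ω → Bool) (hY : Measurable Y) (hZ : Measurable Z) (g : Ω → Bool) (y z : Bool) :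
    (Pr {ω | (g ω = true ∧ Y ω = y) ∧ Z ω = z}).toReal =
      (Pr[|{ω | Y ω = y ∧ Z ω = z}] {ω | g ω = true}).toReal *
        (Pr {ω | Y ω = y ∧ Z ω = z}).toReal := by
  have hm : MeasurableSet {ω | Y ω = y ∧ Z ω = z} :=
    (hY (measurableSet_singleton y)).inter (hZ (measurableSet_singleton z))
  rw [← ENNReal.toReal_mul, cond_mul_eq_inter hm]
  congr 2
  ext ω
  simp only [Set.mem_setOf_eq, Set.mem_inter_iff]
  tauto

/-- Under perfect equalized odds (`Δ_EO(f) = 0`):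
`Acc(f) ≤ max(α, 1 − α) + min(α, 1 − α)·min(d_TV(P₁ᵃ, P₀ᵃ), d_TV(P₁ᵇ, P₀ᵇ))`,
i.e. accuracy is limited by the subgroup with the smaller class-conditional
total variation distance. `Z = true` encodes group `a`, `Z = false` group `b`. -/
theorem perfect_eo_accuracy_bound
    {Ω 𝒳 : Type*} [MeasurableSpace Ω] [MeasurableSpace 𝒳]
    (Pr : Measure Ω) [IsProbabilityMeasure Pr]
    (X : Ω → 𝒳) (hX : Measurable X)
    (Y Z : Ω → Bool) (hY : Measurable Y) (hZ : Measurable Z)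
    (hpos : ∀ y z : Bool, 0 < Pr {ω | Y ω = y ∧ Z ω = z})
    (α : ℝ) (hα : α = (Pr {ω | Y ω = true}).toReal)
    (P₀a P₁a P₀b P₁b : Measure 𝒳)
    (hP₀a : P₀a = (Pr[|{ω | Y ω = false ∧ Z ω = true}]).map X)
    (hP₁a : P₁a = (Pr[|{ω | Y ω = true ∧ Z ω = true}]).map X)
    (hP₀b : P₀b = (Pr[|{ω | Y ω = false ∧ Z ω = false}]).map X)
    (hP₁b : P₁b = (Pr[|{ω | Y ω = true ∧ Z ω = false}]).map X)
    (f : 𝒳 → Bool) (hf : Measurable f)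
    (hEO : max
      |(Pr[|{ω | Z ω = true ∧ Y ω = true}] {ω | f (X ω) = true}).toReal -
        (Pr[|{ω | Z ω = false ∧ Y ω = true}] {ω | f (X ω) = true}).toReal|
      |(Pr[|{ω | Z ω = true ∧ Y ω = false}] {ω | f (X ω) = true}).toReal -
        (Pr[|{ω | Z ω = false ∧ Y ω = false}] {ω | f (X ω) = true}).toReal|
      = 0) :
    (Pr {ω | f (X ω) = Y ω}).toReal
      ≤ max α (1 - α)
        + min α (1 - α) * min (dTV P₁a P₀a) (dTV P₁b P₀b) := by
  have hmax := hEO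
  have hc : ∀ y z : Bool, {ω | Z ω = z ∧ Y ω = y} = {ω | Y ω = y ∧ Z ω = z} := by
    intro y z; ext ω; exact and_comm
  simp only [hc] at hmax
  have h1 := abs_nonpos_iff.1 ((le_max_left _ _).trans hmax.le)
  have h0 := abs_nonpos_iff.1 ((le_max_right _ _).trans hmax.le)
  have hA : MeasurableSet {x | f x = true} := hf (measurableSet_singleton true)
  have hprob : ∀ y z : Bool, IsProbabilityMeasure (Pr[|{ω | Y ω = y ∧ Z ω = z}]) :=
    fun y z => cond_isProbabilityMeasure (hpos y z).ne'
  have hprobX : ∀ y z : Bool,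
      IsProbabilityMeasure ((Pr[|{ω | Y ω = y ∧ Z ω = z}]).map X) := by
    intro y z
    have := hprob y z
    exact Measure.isProbabilityMeasure_map hX.aemeasurable
  have htv : ∀ z : Bool,
      (Pr[|{ω | Y ω = true ∧ Z ω = z}] {ω | f (X ω) = true}).toReal -
        (Pr[|{ω | Y ω = false ∧ Z ω = z}] {ω | f (X ω) = true}).toReal ≤
      dTV ((Pr[|{ω | Y ω = true ∧ Z ω = z}]).map X)
        ((Pr[|{ω | Y ω = false ∧ Z ω = z}]).map X) := by
    intro z
    have := hprobX true z
    have := hprobX false z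
    have h := sub_le_dTV ((Pr[|{ω | Y ω = true ∧ Z ω = z}]).map X)
        ((Pr[|{ω | Y ω = false ∧ Z ω = z}]).map X) hA
    rw [Measure.map_apply hX hA, Measure.map_apply hX hA] at h
    exact h
  have hta := htv true
  have htb := htv false
  rw [← hP₀a, ← hP₁a] at hta
  rw [← hP₀b, ← hP₁b] at htb
  have j := joint_eq Pr Y Z hY hZ (fun ω => f (X ω))
  have j11 := j true true
  have j10 := j true false
  have j01 := j false true
  have j00 := j false false
  have hfX : Measurable (fun ω => f (X ω)) := hf.comp hX
  have s1 := split_bool Pr Z hZ (fun ω => f (X ω) = true ∧ Y ω = true)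
  have s0 := split_bool Pr Z hZ (fun ω => f (X ω) = true ∧ Y ω = false)
  have m1 := split_bool Pr Z hZ (fun ω => Y ω = true)
  have m0 := split_bool Pr Z hZ (fun ω => Y ω = false)
  have t := split_bool Pr Y hY (fun _ => True)
  have u := split_bool Pr _ hfX (fun ω => Y ω = false)
  have a := split_bool Pr Y hY (fun ω => f (X ω) = Y ω)
  have e1 : {ω | f (X ω) = Y ω ∧ Y ω = true} = {ω | f (X ω) = true ∧ Y ω = true} := by
    ext ω; simp only [Set.mem_setOf_eq]; constructor <;> rintro ⟨h, h'⟩ <;> simp_all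
  have e0 : {ω | f (X ω) = Y ω ∧ Y ω = false} = {ω | Y ω = false ∧ f (X ω) = false} := by
    ext ω; simp only [Set.mem_setOf_eq]; constructor <;> rintro ⟨h, h'⟩ <;> simp_all
  have e2 : {ω | Y ω = false ∧ f (X ω) = true} = {ω | f (X ω) = true ∧ Y ω = false} := by
    ext ω; exact and_comm
  rw [e1, e0] at a
  rw [e2] at u
  simp only [true_and, Set.setOf_true, measure_univ, ENNReal.toReal_one] at t
  have p1 : (Pr[|{ω | Y ω = true ∧ Z ω = true}] {ω | f (X ω) = true}).toReal ≤ 1 := by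
    have := hprob true true
    exact measureReal_le_one
  have q0 : 0 ≤ (Pr[|{ω | Y ω = false ∧ Z ω = true}] {ω | f (X ω) = true}).toReal :=
    ENNReal.toReal_nonneg
  rw [← sub_eq_zero.1 h1] at j10 htb
  rw [← sub_eq_zero.1 h0] at j00 htb
  generalize (Pr[|{ω | Y ω = true ∧ Z ω = true}] {ω | f (X ω) = true}).toReal = p at *
  generalize (Pr[|{ω | Y ω = false ∧ Z ω = true}] {ω | f (X ω) = true}).toReal = q at *
  have hS1 : (Pr {ω | f (X ω) = true ∧ Y ω = true}).toReal = p * α := by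
    rw [s1, j11, j10, hα, m1]; ring
  have hS0 : (Pr {ω | f (X ω) = true ∧ Y ω = false}).toReal = q * (1 - α) := by
    have : 1 - α = (Pr {ω | Y ω = false}).toReal := by linarith
    rw [s0, j01, j00, this, m0]; ring
  have hα0 : 0 ≤ α := hα ▸ ENNReal.toReal_nonneg
  have hα1 : 0 ≤ 1 - α := by
    have : 0 ≤ (Pr {ω | Y ω = false}).toReal := ENNReal.toReal_nonneg
    linarith
  have hacc : (Pr {ω | f (X ω) = Y ω}).toReal = p * α + (1 - α) * (1 - q) := by
    linarith
  rw [hacc]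
  have hd := le_min hta htb
  generalize min (dTV P₁a P₀a) (dTV P₁b P₀b) = d at *
  rcases le_total α (1 - α) with h | h
  · rw [max_eq_right h, min_eq_left h]
    nlinarith [mul_le_mul_of_nonneg_left hd hα0, mul_nonneg (sub_nonneg.2 h) q0]
  · rw [max_eq_left h, min_eq_right h]
    nlinarith [mul_le_mul_of_nonneg_left hd hα1,
      mul_nonneg (sub_nonneg.2 h) (sub_nonneg.2 p1)]
end
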